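/- For every positive integer n, the domain 2^[n] is w-pure; moreover, every maximal w-collection in 2^[n] has cardinality n(n+1)/2 + 1. -/

import Mathlib

open Finset

/-- max of a finite set of naturals, with the convention `max0 ∅ = 0`. -/
def max0 (A : Finset ℕ) : ℕ := if h : A.Nonempty then A.max' h else 0

/-- min of a finite set of naturals, with the convention `min0 ∅ = 0`. -/
def min0 (A : Finset ℕ) : ℕ := if h : A.Nonempty then A.min' h else 0

/-- `A < B` : global dominating, i.e. `max A < min B` (with `min ∅ = max ∅ = 0`). -/
def SetLT (A B : Finset ℕ) : Prop := max0 A < min0 B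

/-- `A ⋖ B` : global dominating after cancelations, i.e. `(A − B) < (B − A)`. -/
def LessDot (A B : Finset ℕ) : Prop := SetLT (A \ B) (B \ A)

/-- `A ▷ B` (splitting): `A − B ≠ ∅` and `B − A` is a union of nonempty subsets
`B′, B″` with `B′ < (A − B) < B″`. -/
def Splits (A B : Finset ℕ) : Prop :=
  (A \ B).Nonempty ∧ ∃ B' B'' : Finset ℕ, B'.Nonempty ∧ B''.Nonempty ∧
    B' ∪ B'' = B \ A ∧ SetLT B' (A \ B) ∧ SetLT (A \ B) B''

/-- `A` and `B` are strongly separated. -/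
def StronglySep (A B : Finset ℕ) : Prop := LessDot A B ∨ LessDot B A ∨ A = B

/-- `A` and `B` are weakly separated. -/
def WeaklySep (A B : Finset ℕ) : Prop :=
  StronglySep A B ∨ (Splits A B ∧ B.card ≤ A.card) ∨ (Splits B A ∧ A.card ≤ B.card)

/-- a w-collection: members are pairwise weakly separated. -/
def IsWColl (F : Finset (Finset ℕ)) : Prop := ∀ A ∈ F, ∀ B ∈ F, WeaklySep A B

/-- a maximal w-collection in the domain `D`. -/
def IsMaxWColl (D : Set (Finset ℕ)) (F : Finset (Finset ℕ)) : Prop :=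
  ↑F ⊆ D ∧ IsWColl F ∧
    ∀ G : Finset (Finset ℕ), ↑G ⊆ D → IsWColl G → F ⊆ G → F = G

/-- the domain `D` is w-pure: all maximal w-collections in `D` have the same cardinality. -/
def WPure (D : Set (Finset ℕ)) : Prop :=
  ∀ F G : Finset (Finset ℕ), IsMaxWColl D F → IsMaxWColl D G → F.card = G.card

/-- an s-collection: members are pairwise strongly separated. -/
def IsSColl (F : Finset (Finset ℕ)) : Prop := ∀ A ∈ F, ∀ B ∈ F, StronglySep A B

/-- a maximal s-collection in the domain `D`. -/
def IsMaxSColl (D : Set (Finset ℕ)) (F : Finset (Finset ℕ)) : Prop :=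
  ↑F ⊆ D ∧ IsSColl F ∧
    ∀ G : Finset (Finset ℕ), ↑G ⊆ D → IsSColl G → F ⊆ G → F = G

/-- the domain `D` is s-pure: all maximal s-collections in `D` have the same cardinality. -/
def SPure (D : Set (Finset ℕ)) : Prop :=
  ∀ F G : Finset (Finset ℕ), IsMaxSColl D F → IsMaxSColl D G → F.card = G.card

/-- Every element of `A \ B` is smaller than every element of `B \ A`. -/
def Precedes (A B : Finset ℕ) : Prop := ∀ x ∈ A, x ∉ B → ∀ y ∈ B, y ∉ A → x < y

/-- Some element of `B \ A` lies strictly between two elements of `A \ B`. -/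
def Surrounds (A B : Finset ℕ) : Prop :=
  ∃ x y z, x < y ∧ y < z ∧ (x ∈ A ∧ x ∉ B) ∧ (y ∈ B ∧ y ∉ A) ∧ z ∈ A ∧ z ∉ B

/-- Weak separation, phrased through `Surrounds`; see `weaklySep_iff_wSep`. -/
def WSep (A B : Finset ℕ) : Prop :=
  (Surrounds A B → A.card ≤ B.card) ∧ (Surrounds B A → B.card ≤ A.card) ∧
    ¬ (Surrounds A B ∧ Surrounds B A)

theorem exists_mem_of_card_le {A B : Finset ℕ} (h : A.card ≤ B.card) {x : ℕ} (hx : x ∈ A)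
    (hx' : x ∉ B) : ∃ y ∈ B, y ∉ A := by
  by_contra! hc
  have : B ⊂ A := ⟨hc, fun h' => hx' (h' hx)⟩
  exact absurd (card_lt_card this) (by omega)

theorem exists_mem_of_card_lt {A B : Finset ℕ} (h : A.card < B.card) : ∃ y ∈ B, y ∉ A := by
  by_contra! hc
  exact absurd (card_le_card hc) (by omega)

theorem WSep.symm {A B : Finset ℕ} (h : WSep A B) : WSep B A :=
  ⟨h.2.1, h.1, fun h' => h.2.2 h'.symm⟩

theorem Precedes.trans {A B C : Finset ℕ} (hAB : Precedes A B) (hBC : Precedes B C)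
    (h₁ : A.card ≤ B.card) (h₂ : B.card ≤ C.card) (h : WSep A C) : Precedes A C := by
  intro x hx hx' y hy hy'
  by_contra hlt
  obtain ⟨h3, h4, h5⟩ := h
  by_cases hxB : x ∈ B
  · obtain ⟨z, hz, hz'⟩ := exists_mem_of_card_le h₂ hxB hx'
    have hS : Surrounds C A := ⟨y, x, z, by grind [Precedes]⟩
    have := h4 hS
    obtain ⟨w, hw, hw'⟩ := exists_mem_of_card_le (A := B) (B := A) (by omega)
      (x := y) (by grind [Precedes]) hy'
    exact h5 ⟨⟨w, y, x, by grind [Precedes]⟩, hS⟩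
  · obtain ⟨z, hz, hz'⟩ := exists_mem_of_card_le h₁ hx hxB
    have hS : Surrounds C A := ⟨y, x, z, by grind [Precedes]⟩
    have := h4 hS
    obtain ⟨w, hw, hw'⟩ := exists_mem_of_card_le (A := C) (B := B) (by omega)
      (x := y) hy (by grind [Precedes])
    exact h5 ⟨⟨w, y, x, by grind [Precedes]⟩, hS⟩

theorem wSep_of_precedes {A B : Finset ℕ} (h : Precedes A B) : WSep A B := by
  refine ⟨?_, ?_, ?_⟩
  · rintro ⟨x, y, z, h⟩; grind [Precedes]
  · rintro ⟨x, y, z, h⟩; grind [Precedes]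
  · rintro ⟨⟨x, y, z, h⟩, _⟩; grind [Precedes]

theorem precedes_or {A B : Finset ℕ} (h1 : ¬ Surrounds A B) (h2 : ¬ Surrounds B A) :
    Precedes A B ∨ Precedes B A := by
  by_contra! hc
  simp only [Precedes] at hc
  push Not at hc
  obtain ⟨⟨a, ha, ha', b, hb, hb', hab⟩, ⟨b2, hb2, hb2', a2, ha2, ha2', hab2⟩⟩ := hc
  rcases lt_trichotomy a2 b with h | h | h
  · exact h1 ⟨a2, b, a, by grind⟩
  · grind
  · exact h2 ⟨b, a2, b2, by grind⟩

section InsertExtreme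

variable {A B : Finset ℕ} {n : ℕ}

theorem surrounds_insert_insert (hA : n ∉ A) (hB : n ∉ B) :
    Surrounds (insert n A) (insert n B) ↔ Surrounds A B := by
  constructor
  · rintro ⟨x, y, z, h⟩; exact ⟨x, y, z, by grind⟩
  · rintro ⟨x, y, z, h⟩; exact ⟨x, y, z, by grind⟩

theorem wSep_insert_insert (hA : n ∉ A) (hB : n ∉ B) :
    WSep (insert n A) (insert n B) ↔ WSep A B := by
  simp only [WSep, surrounds_insert_insert hA hB, surrounds_insert_insert hB hA,
    card_insert_of_notMem hA, card_insert_of_notMem hB, Nat.add_le_add_iff_right]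

theorem wSep_insert_top (hA : ∀ x ∈ A, x < n) (hB : ∀ x ∈ B, x < n) :
    WSep A (insert n B) ↔ WSep A B ∧ (Precedes A B ∨ B.card < A.card) := by
  have hnA : n ∉ A := fun h => lt_irrefl _ (hA n h)
  have hnB : n ∉ B := fun h => lt_irrefl _ (hB n h)
  have hc := card_insert_of_notMem hnB
  have h1 : Surrounds A (insert n B) ↔ Surrounds A B := by
    constructor
    · rintro ⟨x, y, z, h⟩; exact ⟨x, y, z, by grind⟩
    · rintro ⟨x, y, z, h⟩; exact ⟨x, y, z, by grind⟩
  have h2 : Surrounds (insert n B) A ↔ ¬ Precedes A B := by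
    constructor
    · rintro ⟨x, y, z, h⟩; grind [Precedes]
    · intro h
      simp only [Precedes] at h
      push Not at h
      obtain ⟨a, ha, ha', b, hb, hb', hab⟩ := h
      exact ⟨b, a, n, by grind⟩
  have h3 : Precedes A B → ¬ Surrounds A B := by
    rintro h ⟨x, y, z, h⟩; grind [Precedes]
  have h4 : Precedes A B → ¬ Surrounds B A := by
    rintro h ⟨x, y, z, h⟩; grind [Precedes]
  have h5 := @precedes_or A B
  have h6 : Precedes B A → ¬ Surrounds A B := by
    rintro h ⟨x, y, z, h⟩; grind [Precedes]
  simp only [WSep, h1, h2, hc]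
  by_cases p : Precedes A B <;> by_cases s : Surrounds A B <;> by_cases t : Surrounds B A <;>
    simp_all <;> omega

theorem wSep_insert_bot (hA : ∀ x ∈ A, n < x) (hB : ∀ x ∈ B, n < x) :
    WSep A (insert n B) ↔ WSep A B ∧ (Precedes B A ∨ B.card < A.card) := by
  have hnA : n ∉ A := fun h => lt_irrefl _ (hA n h)
  have hnB : n ∉ B := fun h => lt_irrefl _ (hB n h)
  have hc := card_insert_of_notMem hnB
  have h1 : Surrounds A (insert n B) ↔ Surrounds A B := by
    constructor
    · rintro ⟨x, y, z, h⟩; exact ⟨x, y, z, by grind⟩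
    · rintro ⟨x, y, z, h⟩; exact ⟨x, y, z, by grind⟩
  have h2 : Surrounds (insert n B) A ↔ ¬ Precedes B A := by
    constructor
    · rintro ⟨x, y, z, h⟩; grind [Precedes]
    · intro h
      simp only [Precedes] at h
      push Not at h
      obtain ⟨a, ha, ha', b, hb, hb', hab⟩ := h
      exact ⟨n, b, a, by grind⟩
  have h3 : Precedes A B → ¬ Surrounds A B := by
    rintro h ⟨x, y, z, h⟩; grind [Precedes]
  have h4 : Precedes B A → ¬ Surrounds B A := by
    rintro h ⟨x, y, z, h⟩; grind [Precedes]
  have h5 := @precedes_or A B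
  have h6 : Precedes B A → ¬ Surrounds A B := by
    rintro h ⟨x, y, z, h⟩; grind [Precedes]
  simp only [WSep, h1, h2, hc]
  by_cases p : Precedes B A <;> by_cases s : Surrounds A B <;> by_cases t : Surrounds B A <;>
    simp_all <;> omega

end InsertExtreme

theorem WSep.not_surrounds {A B : Finset ℕ} (h : WSep A B) (hc : B.card < A.card) {p q r : ℕ}
    (hp : p ∈ A) (hp' : p ∉ B) (hq : q ∈ B) (hq' : q ∉ A) (hr : r ∈ A) (hr' : r ∉ B)
    (hpq : p < q) (hqr : q < r) : False := by
  have := h.1 ⟨p, q, r, hpq, hqr, ⟨hp, hp'⟩, ⟨hq, hq'⟩, hr, hr'⟩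
  omega

set_option maxHeartbeats 1000000 in
theorem Precedes.or_of_card_lt {X Y Z : Finset ℕ} (h : Precedes Y X) (h1 : X.card < Z.card)
    (h2 : Z.card < Y.card) (hXZ : WSep Z X) (hYZ : WSep Y Z) : Precedes Y Z ∨ Precedes Z X := by
  by_contra! hc
  obtain ⟨hc1, hc2⟩ := hc
  simp only [Precedes] at hc1 hc2
  push Not at hc1 hc2
  obtain ⟨y, hyY, hyZ, z, hzZ, hzY, hzy⟩ := hc1
  obtain ⟨z', hzZ', hzX', x, hxX, hxZ, hxz⟩ := hc2
  have a1 := @WSep.not_surrounds _ _ hXZ h1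
  have a2 := @WSep.not_surrounds _ _ hYZ h2
  clear hXZ hYZ
  obtain ⟨w, hw, hw'⟩ := exists_mem_of_card_lt (h1.trans h2)
  clear h1 h2
  simp only [Precedes] at h
  by_cases m1 : z ∈ X <;> by_cases m2 : z' ∈ Y <;> by_cases m3 : x ∈ Y <;>
    by_cases m4 : y ∈ X <;> by_cases m5 : w ∈ Z <;> grind (splits := 20)

theorem eq_of_subset_of_card_succ {C D : Finset ℕ} (h : C ⊆ D) (hc : D.card = C.card + 1)
    {x y : ℕ} (hx : x ∈ D) (hx' : x ∉ C) (hy : y ∈ D) (hy' : y ∉ C) : y = x := by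
  have h1 : (D \ C).card = 1 := by rw [card_sdiff_of_subset h]; omega
  exact card_le_one.1 h1.le _ (by simp [*]) _ (by simp [*])

set_option maxHeartbeats 1000000 in
theorem Precedes.or_of_card_succ {X Y C D : Finset ℕ} (h : Precedes Y X) (h' : Precedes C D)
    (h1 : X.card < C.card) (h2 : D.card = C.card + 1) (h3 : D.card < Y.card) (hXC : WSep C X)
    (hYC : WSep Y C) (hXD : WSep D X) (hYD : WSep Y D) : Precedes Y D ∨ Precedes C X := by
  have t1 := Precedes.or_of_card_lt h (by omega) (by omega) hXC hYC
  have t2 := Precedes.or_of_card_lt h (by omega) (by omega) hXD hYD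
  by_contra! hc
  obtain ⟨hc1, hc2⟩ := hc
  have a1 := @WSep.not_surrounds _ _ hXC (by omega)
  have a2 := @WSep.not_surrounds _ _ hYC (by omega)
  have a3 := @WSep.not_surrounds _ _ hXD (by omega)
  have a4 := @WSep.not_surrounds _ _ hYD (by omega)
  have t1 : Precedes Y C := by tauto
  have t2 : Precedes D X := by tauto
  simp only [Precedes] at hc1 hc2
  push Not at hc1 hc2
  obtain ⟨y, hyY, hyZ, z, hzZ, hzY, hzy⟩ := hc1
  obtain ⟨z', hzZ', hzX', x, hxX, hxZ, hxz⟩ := hc2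
  have hz'D : z' ∈ D := by
    obtain ⟨u, hu, hu'⟩ := exists_mem_of_card_lt (A := X) (B := D) (by omega)
    grind [Precedes]
  have hyC : y ∉ C := by
    obtain ⟨u, hu, hu'⟩ := exists_mem_of_card_lt (A := C) (B := Y) (by omega)
    grind [Precedes]
  have hxD : x ∈ D := by grind [Precedes]
  have hzC : z ∉ C := by grind [Precedes]
  by_cases hxz' : z = x
  · grind [Precedes]
  · obtain ⟨v, hv, hv'⟩ : ∃ v ∈ C, v ∉ D := by
      by_contra! hs
      exact hxz' (eq_of_subset_of_card_succ hs h2 hxD hxZ hzZ hzC)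
    grind [Precedes]

theorem Precedes.subset {A B : Finset ℕ} (h1 : Precedes A B) (h2 : Precedes B A)
    (h : A.card < B.card) : A ⊆ B := by
  intro a ha
  by_contra haB
  obtain ⟨b, hb, hb'⟩ := exists_mem_of_card_lt h
  exact absurd (h1 a ha haB b hb hb') (h2 b hb hb' a ha haB).not_gt

theorem Precedes.eq {A B : Finset ℕ} (h1 : Precedes A B) (h2 : Precedes B A)
    (h : A.card = B.card) : A = B := by
  refine eq_of_subset_of_card_le (fun a ha => ?_) h.ge
  by_contra haB
  obtain ⟨b, hb, hb'⟩ := exists_mem_of_card_le h.le ha haB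
  exact absurd (h1 a ha haB b hb hb') (h2 b hb hb' a ha haB).not_gt

theorem precedes_right_of_subset {X Y C D : Finset ℕ} (hCD : Precedes C D) (hYX : Precedes Y X)
    (hD : D.card = C.card + 1) (hXD : X ⊆ D) (hXC : Precedes X C) (g : ¬ X ⊆ C)
    (hY : ¬ Surrounds Y C) : Precedes Y D := by
  intro y hy hy' z hz hz'
  by_contra hlt
  obtain ⟨x, hx, hx'⟩ := not_subset.1 g
  have hs : C ⊆ D := by
    intro c hc
    by_contra hcD
    have := hCD c hc hcD x (hXD hx) hx'
    have := hXC x hx hx' c hc (fun h => hcD (hXD h))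
    omega
  have := @eq_of_subset_of_card_succ _ _ hs hD x z (hXD hx) hx' hz
  exact hY ⟨x, z, y, by grind [Precedes]⟩

theorem precedes_left_of_subset {X Y C D : Finset ℕ} (hCD : Precedes C D) (hYX : Precedes Y X)
    (hD : D.card = C.card + 1) (hCY : C ⊆ Y) (hDY : Precedes D Y) (g : ¬ D ⊆ Y)
    (hX : ¬ Surrounds D X) : Precedes C X := by
  intro c hc hc' x hx hx'
  by_contra hlt
  obtain ⟨d, hd, hd'⟩ := not_subset.1 g
  have hs : C ⊆ D := by
    intro c hc
    by_contra hcD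
    have := hCD c hc hcD d hd (fun h => hd' (hCY h))
    have := hDY d hd hd' c (hCY hc) hcD
    omega
  have := @eq_of_subset_of_card_succ _ _ hs hD d x hd (fun h => hd' (hCY h))
  exact hX ⟨d, x, c, by grind [Precedes]⟩

theorem precedes_right_of_card_eq {X Y D : Finset ℕ} (hXD : Precedes X D) (hYX : Precedes Y X)
    (h : X.card = D.card) (h' : X.card < Y.card) (hYD : WSep Y D) : Precedes Y D := by
  intro y hy hy' z hz hz'
  by_contra hlt
  have := @WSep.not_surrounds _ _ hYD (by omega)
  obtain ⟨w, hw, hw'⟩ := exists_mem_of_card_lt h'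
  by_cases hzX : z ∈ X
  · grind [Precedes]
  · obtain ⟨p, hp, hp'⟩ := exists_mem_of_card_le h.ge hz hzX
    grind [Precedes]

theorem precedes_left_of_card_eq {X Y C : Finset ℕ} (hCY : Precedes C Y) (hYX : Precedes Y X)
    (h : C.card = Y.card) (h' : X.card < Y.card) (hCX : WSep C X) : Precedes C X := by
  intro c hc hc' x hx hx'
  by_contra hlt
  have := @WSep.not_surrounds _ _ hCX (by omega)
  obtain ⟨w, hw, hw'⟩ := exists_mem_of_card_lt h'
  by_cases hzX : x ∈ Y
  · obtain ⟨p, hp, hp'⟩ := exists_mem_of_card_le h.ge hzX hx'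
    grind [Precedes]
  · grind [Precedes]

theorem precedes_right_of_not_subset {X Y C D : Finset ℕ} (hCD : Precedes C D) (hYX : Precedes Y X)
    (hXD : Precedes X D) (hD : D.card = C.card + 1) (h1 : X.card ≤ D.card)
    (h2 : D.card < Y.card) (hXC : Precedes X C ∨ X.card = D.card)
    (sXD : WSep D X) (sYC : WSep Y C) (sYD : WSep Y D) (g : ¬ X ⊆ C) : Precedes Y D := by
  rcases h1.eq_or_lt with h1 | h1
  · exact precedes_right_of_card_eq hXD hYX h1 (by omega) sYD
  · rcases Precedes.or_of_card_lt hYX h1 h2 sXD sYD with t | t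
    · exact t
    · refine precedes_right_of_subset hCD hYX hD (hXD.subset t h1) (hXC.resolve_right h1.ne) g ?_
      intro hs
      have := sYC.1 hs
      omega

theorem precedes_left_of_not_subset {X Y C D : Finset ℕ} (hCD : Precedes C D) (hYX : Precedes Y X)
    (hCY : Precedes C Y) (hD : D.card = C.card + 1) (h1 : C.card ≤ Y.card)
    (h2 : X.card < C.card) (hDY : Precedes D Y ∨ Y.card = C.card)
    (sYC : WSep Y C) (sXC : WSep C X) (sXD : WSep D X) (g : ¬ D ⊆ Y) : Precedes C X := by
  rcases h1.eq_or_lt with h1 | h1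
  · exact precedes_left_of_card_eq hCY hYX h1 (by omega) sXC
  · rcases Precedes.or_of_card_lt hYX h2 h1 sXC sYC with t | t
    · refine precedes_left_of_subset hCD hYX hD (hCY.subset t h1) (hDY.resolve_right h1.ne') g ?_
      intro hs
      have := sXD.1 hs
      omega
    · exact t

theorem subset_right_of_not_subset {X Y C D : Finset ℕ} (hCD : Precedes C D) (hXY : X ⊆ Y)
    (hCY : Precedes C Y) (hXD : Precedes X D) (hD : D.card = C.card + 1)
    (hDY : Precedes D Y ∨ Y.card = C.card)
    (hXC : Precedes X C ∨ X.card = D.card) (g : ¬ X ⊆ C) : D ⊆ Y := by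
  intro d hd
  by_contra hd'
  have hXD' : Precedes D Y → X ⊆ D := by
    intro h x hx
    by_contra hxD
    have := h d hd hd' x (hXY hx) hxD
    have := hXD x hx hxD d hd (fun h => hd' (hXY h))
    omega
  have hXY' := card_le_card hXY
  rcases hXC with hXC | hXC
  · obtain ⟨x, hx, hx'⟩ := not_subset.1 g
    have hs : C ⊆ Y := by
      intro c hc
      by_contra hcY
      have := hCY c hc hcY x (hXY hx) hx'
      have := hXC x hx hx' c hc (fun h => hcY (hXY h))
      omega
    rcases hDY with hDY | hDY
    · have hXD' := hXD' hDY
      have hs' : C ⊆ D := by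
        intro c hc
        by_contra hcD
        have := hCD c hc hcD x (hXD' hx) hx'
        have := hXC x hx hx' c hc (fun h => hcD (hXD' h))
        omega
      have := eq_of_subset_of_card_succ hs' hD (hXD' hx) hx' hd (fun h => hd' (hs h))
      exact hd' (this ▸ hXY hx)
    · have := eq_of_subset_of_card_le hs hDY.le
      exact hx' (this ▸ hXY hx)
  · rcases hDY with hDY | hDY
    · have := eq_of_subset_of_card_le (hXD' hDY) hXC.ge
      exact hd' (hXY (this ▸ hd))
    · omega

section PrecedesTop

variable {A B : Finset ℕ} {n : ℕ}

theorem precedes_insert_right (hA : ∀ x ∈ A, x < n) :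
    Precedes A (insert n B) ↔ Precedes A B := by
  simp only [Precedes]; constructor
  · intro h x hx hx' y hy hy'
    exact h x hx (by grind) y (by grind) hy'
  · intro h x hx hx' y hy hy'
    grind

theorem precedes_insert_left (hB : ∀ x ∈ B, x < n) :
    Precedes (insert n A) B ↔ B ⊆ A := by
  simp only [Precedes]; constructor
  · intro h y hy
    have := hB y hy
    by_contra hc
    have := h n (by simp) (by grind) y hy (by grind)
    omega
  · intro h x hx hx' y hy hy'
    grind

theorem precedes_insert_insert (hA : ∀ x ∈ A, x < n) (hB : ∀ x ∈ B, x < n) :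
    Precedes (insert n A) (insert n B) ↔ Precedes A B := by
  simp only [Precedes]; constructor
  · intro h x hx hx' y hy hy'
    exact h x (by grind) (by grind) y (by grind) (by grind)
  · intro h x hx hx' y hy hy'
    exact h x (by grind) (by grind) y (by grind) (by grind)

theorem exists_eq_insert_top (hA : ∀ x ∈ A, x ≤ n) (h : n ∈ A) :
    ∃ A', (∀ x ∈ A', x < n) ∧ A = insert n A' ∧ A.card = A'.card + 1 := by
  refine ⟨A.erase n, fun x hx => ?_, (insert_erase h).symm, ?_⟩
  · have := hA x (mem_of_mem_erase hx)
    have := ne_of_mem_erase hx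
    omega
  · rw [card_erase_of_mem h]
    have := card_pos.2 ⟨n, h⟩
    omega

theorem lt_of_notMem_top (hA : ∀ x ∈ A, x ≤ n) (h : n ∉ A) : ∀ x ∈ A, x < n :=
  fun x hx => lt_of_le_of_ne (hA x hx) (fun h' => h (h' ▸ hx))

end PrecedesTop

theorem precedes_insert_or_precedes {n : ℕ} {X Y C D : Finset ℕ} (hC : ∀ x ∈ C, x < n)
    (hD : ∀ x ∈ D, x < n) (hX : ∀ x ∈ X, x ≤ n) (hY : ∀ x ∈ Y, x ≤ n)
    (hCD : Precedes C D) (hYX : Precedes Y X) (hc : D.card = C.card + 1) (h1 : X.card ≤ D.card)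
    (h2 : D.card ≤ Y.card)
    (sXY : WSep X Y) (sXC : WSep X C) (sXC' : WSep X (insert n C)) (sXD : WSep X D)
    (sXD' : WSep X (insert n D)) (sYC : WSep Y C) (sYC' : WSep Y (insert n C)) (sYD : WSep Y D)
    (sYD' : WSep Y (insert n D)) : Precedes (insert n C) X ∨ Precedes Y D := by
  have nC : n ∉ C := fun h => lt_irrefl _ (hC n h)
  have nD : n ∉ D := fun h => lt_irrefl _ (hD n h)
  by_cases hnX : n ∈ X <;> by_cases hnY : n ∈ Y
  · obtain ⟨X, hX', rfl, eX⟩ := exists_eq_insert_top hX hnX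
    replace hX := hX'
    obtain ⟨Y, hY', rfl, eY⟩ := exists_eq_insert_top hY hnY
    replace hY := hY'
    have nX : n ∉ X := fun h => lt_irrefl _ (hX n h)
    have nY : n ∉ Y := fun h => lt_irrefl _ (hY n h)
    rw [wSep_insert_insert nX nC] at sXC'
    rw [wSep_insert_insert nX nD] at sXD'
    rw [wSep_insert_insert nY nC] at sYC'
    rw [wSep_insert_insert nY nD] at sYD'
    rw [precedes_insert_insert hY hX] at hYX
    replace sXC := ((wSep_insert_top hC hX).1 sXC.symm).2
    replace sYC := ((wSep_insert_top hC hY).1 sYC.symm).2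
    replace sYD := ((wSep_insert_top hD hY).1 sYD.symm).2
    rw [precedes_insert_insert hC hX, precedes_insert_left hD]
    by_contra! hcon
    exact hcon.1 (precedes_left_of_not_subset hCD hYX (sYC.resolve_right (by omega)) hc (by omega)
      (sXC.resolve_left hcon.1) (sYD.imp_right (by omega)) sYC' sXC'.symm sXD'.symm hcon.2)
  · obtain ⟨X, hX', rfl, eX⟩ := exists_eq_insert_top hX hnX
    replace hX := hX'
    replace hY := lt_of_notMem_top hY hnY
    have nX : n ∉ X := fun h => lt_irrefl _ (hX n h)
    rw [wSep_insert_insert nX nC] at sXC'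
    rw [wSep_insert_insert nX nD] at sXD'
    rw [precedes_insert_right hY] at hYX
    replace sXC := ((wSep_insert_top hC hX).1 sXC.symm).2
    replace sYD' := ((wSep_insert_top hY hD).1 sYD').2
    rw [precedes_insert_insert hC hX]
    by_contra! hcon
    have := Precedes.or_of_card_succ hYX hCD (sXC.resolve_left hcon.1) (by omega)
      (sYD'.resolve_left hcon.2) sXC'.symm sYC sXD'.symm sYD
    tauto
  · obtain ⟨Y, hY', rfl, eY⟩ := exists_eq_insert_top hY hnY
    replace hY := hY'
    have nY : n ∉ Y := fun h => lt_irrefl _ (hY n h)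
    replace hX := lt_of_notMem_top hX hnX
    rw [precedes_insert_left hX] at hYX
    rw [precedes_insert_left hX, precedes_insert_left hD]
    replace sXC' := ((wSep_insert_top hX hC).1 sXC').2
    replace sXD' := ((wSep_insert_top hX hD).1 sXD').2
    replace sYC := ((wSep_insert_top hC hY).1 sYC.symm).2
    replace sYD := ((wSep_insert_top hD hY).1 sYD.symm).2
    refine or_iff_not_imp_left.2 fun g => ?_
    exact subset_right_of_not_subset hCD hYX (sYC.resolve_right (by omega))
      (sXD'.resolve_right (by omega)) hc (sYD.imp_right (by omega)) (sXC'.imp_right (by omega)) g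
  · replace hX := lt_of_notMem_top hX hnX
    replace hY := lt_of_notMem_top hY hnY
    rw [precedes_insert_left hX]
    replace sXC' := ((wSep_insert_top hX hC).1 sXC').2
    replace sXD' := ((wSep_insert_top hX hD).1 sXD').2
    replace sYD' := ((wSep_insert_top hY hD).1 sYD').2
    refine or_iff_not_imp_left.2 fun g => ?_
    rcases sYD' with h | h
    · exact h
    · exact precedes_right_of_not_subset hCD hYX (sXD'.resolve_right (by omega)) hc h1 h
        (sXC'.imp_right (by omega)) sXD.symm sYC sYD g

theorem WSep.erase_bot {a : ℕ} {X Y : Finset ℕ} (hX : ∀ x ∈ X, a ≤ x) (hY : ∀ x ∈ Y, a ≤ x)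
    (h : WSep X Y) : WSep (X.erase a) (Y.erase a) := by
  have lt : ∀ {Z : Finset ℕ}, (∀ z ∈ Z, a ≤ z) → ∀ z ∈ Z.erase a, a < z := fun hZ z hz =>
    lt_of_le_of_ne (hZ z (mem_of_mem_erase hz)) (ne_of_mem_erase hz).symm
  by_cases hx : a ∈ X <;> by_cases hy : a ∈ Y
  · rw [← insert_erase hx, ← insert_erase hy] at h
    exact (wSep_insert_insert (notMem_erase a X) (notMem_erase a Y)).1 h
  · rw [← insert_erase hx, ← erase_eq_of_notMem hy] at h
    exact ((wSep_insert_bot (lt hY) (lt hX)).1 h.symm).1.symm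
  · rw [← insert_erase hy, ← erase_eq_of_notMem hx] at h
    exact ((wSep_insert_bot (lt hX) (lt hY)).1 h).1
  · rwa [erase_eq_of_notMem hx, erase_eq_of_notMem hy]

theorem Precedes.of_insert_left {n : ℕ} {A B : Finset ℕ} (hA : ∀ x ∈ A, x < n)
    (h : Precedes (insert n A) B) : Precedes A B := by
  intro x hx hx' y hy hy'
  by_cases hyn : y = n
  · exact hyn ▸ hA x hx
  · exact h x (mem_insert_of_mem hx) hx' y hy (by simp [hyn, hy'])

theorem Precedes.insert_right {n : ℕ} {A B : Finset ℕ} (hA : ∀ x ∈ A, x ≤ n)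
    (h : Precedes A B) : Precedes A (insert n B) := by
  intro x hx hx' y hy hy'
  rw [mem_insert, not_or] at hx'
  rcases mem_insert.1 hy with rfl | hy
  · exact lt_of_le_of_ne (hA x hx) hx'.1
  · exact h x hx hx'.2 y hy hy'

/-- A pairwise weakly separated family in `[a, n]` admits, on every level `k`, a set `A ⊆ [a, n)`
such that both `A` and `A ∪ {n}` are compatible with the family. -/
theorem exists_card_eq_wSep (n : ℕ) : ∀ d a : ℕ, a + d = n → ∀ F : Finset (Finset ℕ),
    (∀ X ∈ F, X ⊆ Icc a n) → (∀ X ∈ F, ∀ Y ∈ F, WSep X Y) → ∀ k ≤ d,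
    ∃ A ⊆ Ico a n, A.card = k ∧ ∀ X ∈ F, WSep X A ∧ WSep X (insert n A) := by
  intro d
  induction d with
  | zero =>
    intro a ha F hF _ k hk
    refine ⟨∅, by simp, by simp; omega, fun X hX => ⟨?_, ?_⟩⟩
    · exact wSep_of_precedes (by simp [Precedes])
    · refine wSep_of_precedes ?_
      intro x hx hx' y hy hy'
      have := mem_Icc.1 (hF X hX hx)
      grind
  | succ d ih =>
    intro a ha F hF hFW k hk
    rcases Nat.eq_zero_or_pos k with rfl | hk0
    · refine ⟨∅, by simp, by simp, fun X hX => ⟨?_, ?_⟩⟩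
      · exact wSep_of_precedes (by simp [Precedes])
      · refine wSep_of_precedes ?_
        intro x hx hx' y hy hy'
        have := mem_Icc.1 (hF X hX hx)
        grind
    rcases hk.eq_or_lt with rfl | hk
    · refine ⟨Ico a n, by simp, by simp; omega, fun X hX => ⟨?_, ?_⟩⟩
      · refine (wSep_of_precedes ?_).symm
        intro x hx hx' y hy hy'
        have := mem_Icc.1 (hF X hX hy)
        grind
      · refine (wSep_of_precedes ?_).symm
        intro x hx hx' y hy hy'
        have := mem_Icc.1 (hF X hX hy)
        grind
    have hle : ∀ X ∈ F, ∀ x ∈ X, a ≤ x := fun X hX x hx => (mem_Icc.1 (hF X hX hx)).1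
    have hle' : ∀ X ∈ F, ∀ x ∈ X, x ≤ n := fun X hX x hx => (mem_Icc.1 (hF X hX hx)).2
    have lt : ∀ X ∈ F, ∀ x ∈ X.erase a, a < x := fun X hX x hx =>
      lt_of_le_of_ne (hle X hX x (mem_of_mem_erase hx)) (ne_of_mem_erase hx).symm
    set G := F.image (fun X => X.erase a) with hG
    have hGs : ∀ X ∈ G, X ⊆ Icc (a + 1) n := by
      intro X hX x hx
      obtain ⟨X, hX', rfl⟩ := mem_image.1 hX
      have := lt X hX' x hx
      have := hle' X hX' x (mem_of_mem_erase hx)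
      simp; omega
    have hGW : ∀ X ∈ G, ∀ Y ∈ G, WSep X Y := by
      intro X hX Y hY
      obtain ⟨X, hX', rfl⟩ := mem_image.1 hX
      obtain ⟨Y, hY', rfl⟩ := mem_image.1 hY
      exact (hFW X hX' Y hY').erase_bot (hle X hX') (hle Y hY')
    obtain ⟨C, hCs, hCc, hC⟩ := ih (a + 1) (by omega) G hGs hGW (k - 1) (by omega)
    have hCn : ∀ x ∈ C, x < n := fun x hx => (mem_Ico.1 (hCs hx)).2
    have hCa : ∀ x ∈ C, a < x := fun x hx => (mem_Ico.1 (hCs hx)).1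
    have hCC : WSep C (insert n C) := wSep_of_precedes (by intro x; grind)
    have hself : ∀ X : Finset ℕ, WSep X X := fun X => wSep_of_precedes (by intro x; grind)
    obtain ⟨D, hDs, hDc, hD⟩ := ih (a + 1) (by omega) (insert C (insert (insert n C) G))
      (by
        intro X hX
        simp only [mem_insert] at hX
        rcases hX with rfl | rfl | hX
        · exact hCs.trans Ico_subset_Icc_self
        · refine insert_subset (by simp; omega) (hCs.trans Ico_subset_Icc_self)
        · exact hGs X hX)
      (by
        intro X hX Y hY
        simp only [mem_insert] at hX hY
        rcases hX with rfl | rfl | hX <;> rcases hY with rfl | rfl | hY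
        · exact hself _
        · exact hCC
        · exact (hC Y hY).1.symm
        · exact hCC.symm
        · exact hself _
        · exact (hC Y hY).2.symm
        · exact (hC X hX).1
        · exact (hC X hX).2
        · exact hGW X hX Y hY) k (by omega)
    have hDn : ∀ x ∈ D, x < n := fun x hx => (mem_Ico.1 (hDs hx)).2
    have hDa : ∀ x ∈ D, a < x := fun x hx => (mem_Ico.1 (hDs hx)).1
    have hCD : Precedes C D :=
      ((wSep_insert_top hCn hDn).1 (hD C (by simp)).2).2.resolve_right (by omega)
    have hGD : ∀ X ∈ G, WSep X D ∧ WSep X (insert n D) := fun X hX => hD X (by simp [hX])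
    have hIco : Ico (a + 1) n ⊆ Ico a n := Ico_subset_Ico (by omega) le_rfl
    by_cases hgood : ∀ X ∈ F, WSep X D ∧ WSep X (insert n D)
    · exact ⟨D, hDs.trans hIco, hDc, hgood⟩
    push Not at hgood
    obtain ⟨Y, hY, hYbad⟩ := hgood
    have haY : a ∈ Y := by
      by_contra haY
      have := hGD Y (mem_image.2 ⟨Y, hY, erase_eq_of_notMem haY⟩)
      exact hYbad this.1 this.2
    have hnC : n ∉ C := fun h => lt_irrefl _ (hCn n h)
    have hnD : n ∉ D := fun h => lt_irrefl _ (hDn n h)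
    have haC : a ∉ C := fun h => lt_irrefl _ (hCa a h)
    have hins : ∀ {Z : Finset ℕ}, (∀ x ∈ Z, a < x) → ∀ x ∈ insert n Z, a < x := by
      intro Z hZ x hx
      rcases mem_insert.1 hx with rfl | hx
      · omega
      · exact hZ x hx
    have hYG : Y.erase a ∈ G := mem_image_of_mem _ hY
    have hYD : ¬ Precedes (Y.erase a) D ∧ D.card ≤ (Y.erase a).card := by
      have h1 := wSep_insert_bot hDa (lt Y hY)
      have h2 := wSep_insert_bot (hins hDa) (lt Y hY)
      rw [insert_erase haY] at h1 h2
      have h3 : WSep D Y → ¬ WSep (insert n D) Y := fun h h' => hYbad h.symm h'.symm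
      rw [h1, h2, card_insert_of_notMem hnD] at h3
      have h4 := (hGD _ hYG).1.symm
      have h5 := (hGD _ hYG).2.symm
      have h6 : Precedes (Y.erase a) D → Precedes (Y.erase a) (insert n D) :=
        Precedes.insert_right fun x hx => hle' Y hY x (mem_of_mem_erase hx)
      refine ⟨fun h => h3 ⟨h4, Or.inl h⟩ ⟨h5, Or.inl (h6 h)⟩, ?_⟩
      by_contra! hlt
      exact h3 ⟨h4, Or.inr hlt⟩ ⟨h5, Or.inr (by omega)⟩
    refine ⟨insert a C, insert_subset (by simp; omega) (hCs.trans hIco),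
      by rw [card_insert_of_notMem haC]; omega, fun X hX => ?_⟩
    rw [insert_comm]
    have hXG : X.erase a ∈ G := mem_image_of_mem _ hX
    by_cases haX : a ∈ X
    · have hanC : a ∉ insert n C := fun h => lt_irrefl _ (hins hCa a h)
      rw [← insert_erase haX, wSep_insert_insert (notMem_erase a X) haC,
        wSep_insert_insert (notMem_erase a X) hanC]
      exact hC _ hXG
    · have hXa := lt X hX
      rw [erase_eq_of_notMem haX] at hXG hXa
      rw [wSep_insert_bot hXa hCa, wSep_insert_bot hXa (hins hCa), card_insert_of_notMem hnC]
      suffices h : Precedes (insert n C) X ∨ C.card + 1 < X.card by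
        refine ⟨⟨(hC X hXG).1, h.imp (Precedes.of_insert_left hCn) (by omega)⟩,
          (hC X hXG).2, h⟩
      by_contra! hcon
      have hYX : Precedes (Y.erase a) X := by
        have := hFW X hX Y hY
        rw [← insert_erase haY, wSep_insert_bot hXa (lt Y hY)] at this
        exact this.2.resolve_right (by omega)
      have := precedes_insert_or_precedes hCn hDn (hle' X hX)
        (fun x hx => hle' Y hY x (mem_of_mem_erase hx)) hCD hYX (by omega) (by omega) hYD.2
        (hGW _ hXG _ hYG) (hC _ hXG).1 (hC _ hXG).2 (hGD _ hXG).1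
        (hGD _ hXG).2 (hC _ hYG).1 (hC _ hYG).2 (hGD _ hYG).1 (hGD _ hYG).2
      tauto

theorem card_insert_erase {n b : ℕ} {B : Finset ℕ} (hb : b ∈ B) (hn : n ∉ B) :
    (insert n (B.erase b)).card = B.card := by
  rw [card_insert_of_notMem (fun h => hn (mem_of_mem_erase h)), card_erase_of_mem hb]
  have := card_pos.2 ⟨b, hb⟩
  omega

theorem exchange_lift {n b : ℕ} {A Y : Finset ℕ} (hA : ∀ x ∈ A, x < n) (hY : ∀ x ∈ Y, x ≤ n)
    (hb : b ∈ A) (h : Precedes Y A ∨ Y.card < A.card)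
    (hYW : WSep Y (insert n (A.erase b))) :
    Precedes Y (insert n (A.erase b)) ∨ Y.card < A.card := by
  by_contra! hcon
  obtain ⟨h1, hc⟩ := hcon
  replace h := h.resolve_right (by omega)
  simp only [Precedes] at h1
  push Not at h1
  obtain ⟨y, hy, hy', w, hw, hw', hwy⟩ := h1
  have hyn := hY y hy
  have hwA : w ∈ A ∧ w ≠ b := by grind
  have hyb : y = b := by grind [Precedes]
  obtain ⟨u, hu, hu'⟩ := exists_mem_of_card_le hc hwA.1 hw'
  have huw := h u hu hu' w hwA.1 hw'
  exact hYW.2.2 ⟨⟨u, w, y, by grind⟩, ⟨w, y, n, by grind [Precedes]⟩⟩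

theorem exchange_conflict {n b : ℕ} {B X Y : Finset ℕ} (hB : ∀ x ∈ B, x < n)
    (hX : ∀ x ∈ X, x ≤ n) (hY : ∀ x ∈ Y, x ≤ n) (hb : b ∈ B) (hcX : X.card ≤ B.card)
    (hcY : B.card < Y.card) (hBX : Precedes (insert n B) X) (hYX : Precedes Y X)
    (hXW : WSep X (insert n (B.erase b))) (hYB : WSep Y B)
    (hYW : WSep Y (insert n (B.erase b))) (h1 : ¬ Precedes (insert n (B.erase b)) X) :
    Precedes Y (insert n B) := by
  have hnB : n ∉ B := fun h => lt_irrefl _ (hB n h)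
  have hcW := card_insert_erase hb hnB
  have hbn := hB b hb
  have hbW : b ∉ insert n (B.erase b) := by simp [hbn.ne]
  have hWB : ∀ {p}, p ∈ B → p ≠ b → p ∈ insert n (B.erase b) := fun h h' =>
    mem_insert_of_mem (mem_erase.2 ⟨h', h⟩)
  have hBX' : ∀ p ∈ B, p ∉ X → ∀ q ∈ X, q ∉ B → q ≠ n → p < q := fun p hp hp' q hq hq' hqn =>
    hBX p (mem_insert_of_mem hp) hp' q hq (by simp [hq', hqn])
  by_contra h2
  simp only [Precedes] at h1 h2
  push Not at h1 h2
  obtain ⟨w, hw, hw', x, hx, hx', hxw⟩ := h1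
  obtain ⟨y, hy, hy', z, hz, hz', hzy⟩ := h2
  rw [mem_insert, not_or] at hy' hx'
  have hyn := lt_of_le_of_ne (hY y hy) hy'.1
  have hzy : z < y := lt_of_le_of_ne hzy (fun h => hz' (h ▸ hy))
  have hxw : x < w := lt_of_le_of_ne hxw (fun h => hw' (h ▸ hx))
  have hzB : z ∈ B := (mem_insert.1 hz).resolve_left (by omega)
  have hyW : y ∉ insert n (B.erase b) := by simp [hy'.1, hy'.2]
  have hbz : b ∈ Y → b < z → False := fun h hlt =>
    hYW.not_surrounds (by omega) h hbW (hWB hzB hlt.ne') hz' hy hyW hlt hzy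
  by_cases hnX : n ∈ X
  · have hwB : w ∈ B := mem_of_mem_erase
      ((mem_insert.1 hw).resolve_left (fun h => hw' (h ▸ hnX)))
    have hxb : x = b := by
      by_contra hxb
      have hxB : x ∉ B := fun h => hx'.2 (mem_erase.2 ⟨hxb, h⟩)
      have := hBX' w hwB hw' x hx hxB hx'.1
      omega
    subst hxb
    have key : ∀ p ∈ B, p ∉ X → x < p := by
      intro p hp hp'
      by_contra hlt
      have hpx : p ≠ x := fun h => hp' (h ▸ hx)
      have hS : Surrounds (insert n (B.erase x)) X :=
        ⟨p, x, w, by omega, hxw, ⟨hWB hp hpx, hp'⟩, ⟨hx, hbW⟩, hw, hw'⟩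
      have hc := hXW.2.1 hS
      obtain ⟨u, hu, hu', hun⟩ : ∃ u ∈ X, u ∉ B ∧ u ≠ n := by
        by_contra! hcon
        have h3 : (X \ B).card ≤ 1 := by
          refine card_le_one.2 fun s hs t ht => ?_
          rw [mem_sdiff] at hs ht
          rw [hcon s hs.1 hs.2, hcon t ht.1 ht.2]
        have h4 : 1 < (B \ X).card :=
          one_lt_card.2 ⟨p, by simp [hp, hp'], w, by simp [hwB, hw'], by omega⟩
        have := card_sdiff_add_card_inter X B
        have := card_sdiff_add_card_inter B X
        rw [inter_comm] at this
        omega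
      exact hXW.2.2 ⟨⟨x, w, u, hxw, hBX' w hwB hw' u hu hu' hun, ⟨hx, hbW⟩, ⟨hw, hw'⟩, hu,
        by simp [hun, hu']⟩, hS⟩
    have hzx : x < z := by
      by_cases hzX : z ∈ X
      · by_contra hzx
        have hyX : y ∈ X := by
          by_contra hyX
          have := hYX y hy hyX z hzX hz'
          omega
        obtain ⟨u, hu, hu'⟩ := exists_mem_of_card_lt (hcX.trans_lt hcY)
        have huz := hYX u hu hu' z hzX hz'
        by_cases huB : u ∈ B
        · have := key u huB hu'
          omega
        · exact hYB.not_surrounds hcY hu huB hzB hz' hy hy'.2 huz hzy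
      · exact key z hzB hzX
    have hxY : x ∉ Y := fun h => hbz h hzx
    obtain ⟨u, hu, hu'⟩ := exists_mem_of_card_lt (hcX.trans_lt hcY)
    have hux := hYX u hu hu' x hx hxY
    have huB : u ∉ B := fun h => by
      have := key u h hu'
      omega
    exact hYB.not_surrounds hcY hu huB hzB hz' hy hy'.2 (hux.trans hzx) hzy
  · have hXB : X ⊆ B := by
      intro p hp
      by_contra hpB
      have hpn : p ≠ n := fun h => hnX (h ▸ hp)
      have h3 := hBX n (mem_insert_self _ _) hnX p hp (by simp [hpn, hpB])
      have := hX p hp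
      omega
    have hxb : x = b := by
      by_contra hxb
      exact hx'.2 (mem_erase.2 ⟨hxb, hXB hx⟩)
    subst hxb
    have hzX : z ∉ X := fun h => by
      have := hYX y hy (fun h => hy'.2 (hXB h)) z h hz'
      omega
    have hzx : x < z := by
      by_contra hlt
      have hzx : z ≠ x := fun h => hzX (h ▸ hx)
      have hc := hXW.2.1 ⟨z, x, w, by omega, hxw, ⟨hWB hzB hzx, hzX⟩, ⟨hx, hbW⟩, hw, hw'⟩
      have := eq_of_subset_of_card_le hXB (by omega)
      exact hzX (this ▸ hzB)
    have hxY : x ∉ Y := fun h => hbz h hzx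
    have := hYX y hy (fun h => hy'.2 (hXB h)) x hx hxY
    omega

theorem WSep.refl (A : Finset ℕ) : WSep A A := wSep_of_precedes (by intro x; grind)

/-- If `A` and `A ∪ {n}` are compatible with a pairwise weakly separated family, then so is
`(A \ {b}) ∪ {n}` for some `b ∈ A`. -/
theorem exists_exchange_wSep (n : ℕ) : ∀ d a : ℕ, a + d = n → ∀ F : Finset (Finset ℕ),
    (∀ X ∈ F, X ⊆ Icc a n) → (∀ X ∈ F, ∀ Y ∈ F, WSep X Y) → ∀ A ⊆ Ico a n, A.Nonempty →
    (∀ X ∈ F, WSep X A ∧ WSep X (insert n A)) →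
    ∃ b ∈ A, ∀ X ∈ F, WSep X (insert n (A.erase b)) := by
  intro d
  induction d with
  | zero =>
    intro a ha F _ _ A hA hne
    obtain ⟨x, hx⟩ := hne
    have := mem_Ico.1 (hA hx)
    omega
  | succ d ih =>
    intro a ha F hF hFW A hA hne hFA
    have hle : ∀ X ∈ F, ∀ x ∈ X, a ≤ x := fun X hX x hx => (mem_Icc.1 (hF X hX hx)).1
    have hle' : ∀ X ∈ F, ∀ x ∈ X, x ≤ n := fun X hX x hx => (mem_Icc.1 (hF X hX hx)).2
    have hler : ∀ X ∈ F, ∀ x ∈ X.erase a, x ≤ n := fun X hX x hx =>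
      hle' X hX x (mem_of_mem_erase hx)
    have lt : ∀ X ∈ F, ∀ x ∈ X.erase a, a < x := fun X hX x hx =>
      lt_of_le_of_ne (hle X hX x (mem_of_mem_erase hx)) (ne_of_mem_erase hx).symm
    set G := F.image (fun X => X.erase a) with hG
    have hGs : ∀ X ∈ G, X ⊆ Icc (a + 1) n := by
      intro X hX x hx
      obtain ⟨X, hX', rfl⟩ := mem_image.1 hX
      have := lt X hX' x hx
      have := hler X hX' x hx
      simp; omega
    have hGW : ∀ X ∈ G, ∀ Y ∈ G, WSep X Y := by
      intro X hX Y hY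
      obtain ⟨X, hX', rfl⟩ := mem_image.1 hX
      obtain ⟨Y, hY', rfl⟩ := mem_image.1 hY
      exact (hFW X hX' Y hY').erase_bot (hle X hX') (hle Y hY')
    have hAn : ∀ x ∈ A, x < n := fun x hx => (mem_Ico.1 (hA hx)).2
    have hAa : ∀ x ∈ A, a ≤ x := fun x hx => (mem_Ico.1 (hA hx)).1
    have hnA : n ∉ A := fun h => lt_irrefl _ (hAn n h)
    have hnAa : ∀ x ∈ insert n A, a ≤ x := by
      intro x hx
      rcases mem_insert.1 hx with rfl | hx
      · omega
      · exact hAa x hx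
    have hmem : ∀ X ∈ F, X.erase a ∈ G := fun X hX => mem_image_of_mem _ hX
    have hGA : ∀ X ∈ G, WSep X (A.erase a) ∧ WSep X (insert n (A.erase a)) := by
      intro X hX
      obtain ⟨X, hX', rfl⟩ := mem_image.1 hX
      rw [← erase_insert_of_ne (by omega : n ≠ a)]
      exact ⟨(hFA X hX').1.erase_bot (hle X hX') hAa, (hFA X hX').2.erase_bot (hle X hX') hnAa⟩
    have hBs : A.erase a ⊆ Ico (a + 1) n := by
      intro x hx
      have := hAn x (mem_of_mem_erase hx)
      have := hAa x (mem_of_mem_erase hx)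
      have := ne_of_mem_erase hx
      simp; omega
    have hins : ∀ {Z : Finset ℕ}, (∀ x ∈ Z, a < x) → ∀ x ∈ insert n Z, a < x := by
      intro Z hZ x hx
      rcases mem_insert.1 hx with rfl | hx
      · omega
      · exact hZ x hx
    by_cases haA : a ∈ A
    · set B := A.erase a with hB
      have hBn : ∀ x ∈ B, x < n := fun x hx => (mem_Ico.1 (hBs hx)).2
      have hBa : ∀ x ∈ B, a < x := fun x hx => (mem_Ico.1 (hBs hx)).1
      have hnB : n ∉ B := fun h => lt_irrefl _ (hBn n h)
      have haB : a ∉ insert n B := fun h => lt_irrefl _ (hins hBa a h)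
      have hAB : A = insert a B := (insert_erase haA).symm
      rcases B.eq_empty_or_nonempty with hB0 | hBne
      · refine ⟨a, haA, fun X hX => ?_⟩
        rw [← hB, hB0]
        refine wSep_of_precedes ?_
        intro x hx hx' y hy hy'
        have := hle' X hX x hx
        grind
      obtain ⟨b, hb, hbG⟩ := ih (a + 1) (by omega) G hGs hGW B hBs hBne hGA
      have hWa : ∀ x ∈ insert n (B.erase b), a < x :=
        hins fun x hx => hBa x (mem_of_mem_erase hx)
      have haW : a ∉ insert n (B.erase b) := fun h => lt_irrefl _ (hWa a h)
      have hcW := card_insert_erase hb hnB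
      have hbA : b ∈ A := mem_of_mem_erase hb
      have hAW : insert n (A.erase b) = insert a (insert n (B.erase b)) := by
        rw [hAB, erase_insert_of_ne (hBa b hb).ne, insert_comm]
      by_cases hgb : ∀ X ∈ F, WSep X (insert n (A.erase b))
      · exact ⟨b, hbA, hgb⟩
      by_cases hga : ∀ X ∈ F, WSep X (insert n B)
      · exact ⟨a, haA, hga⟩
      exfalso
      push Not at hgb hga
      obtain ⟨X, hX, hXb⟩ := hgb
      obtain ⟨Y, hY, hYb⟩ := hga
      have haX : a ∉ X := by
        intro haX
        rw [hAW, ← insert_erase haX, wSep_insert_insert (notMem_erase a X) haW] at hXb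
        exact hXb (hbG _ (hmem X hX))
      have hXa := lt X hX
      have hXG := hmem X hX
      rw [erase_eq_of_notMem haX] at hXa hXG
      rw [hAW, wSep_insert_bot hXa hWa] at hXb
      obtain ⟨hX2, hX3⟩ := not_or.1 fun h => hXb ⟨hbG X hXG, h⟩
      have haY : a ∈ Y := by
        by_contra haY
        have := hmem Y hY
        rw [erase_eq_of_notMem haY] at this
        exact hYb (hGA Y this).2
      have hYG := hmem Y hY
      have hnBa := hins hBa
      have hYb' := fun h => hYb (WSep.symm h)
      rw [← insert_erase haY, wSep_insert_bot hnBa (lt Y hY)] at hYb'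
      obtain ⟨hY2, hY3⟩ := not_or.1 fun h => hYb' ⟨(hGA _ hYG).2.symm, h⟩
      rw [card_insert_of_notMem hnB] at hY3
      have hXA := (hFA X hX).2
      rw [hAB, insert_comm, wSep_insert_bot hXa hnBa, card_insert_of_notMem hnB] at hXA
      have hXY := hFW X hX Y hY
      rw [← insert_erase haY, wSep_insert_bot hXa (lt Y hY)] at hXY
      exact hY2 (exchange_conflict hBn (hle' X hX) (hler Y hY) hb (by omega) (by omega)
        (hXA.2.resolve_right (by omega)) (hXY.2.resolve_right (by omega)) (hbG X hXG)
        (hGA _ hYG).1 (hbG _ hYG) hX2)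
    · rw [erase_eq_of_notMem haA] at hGA hBs
      obtain ⟨b, hb, hbG⟩ := ih (a + 1) (by omega) G hGs hGW A hBs hne hGA
      refine ⟨b, hb, fun X hX => ?_⟩
      have hXG := hmem X hX
      by_cases haX : a ∈ X
      · have hA1 : ∀ x ∈ A, a < x := fun x hx => (mem_Ico.1 (hBs hx)).1
        have hWa : ∀ x ∈ insert n (A.erase b), a < x :=
          hins fun x hx => hA1 x (mem_of_mem_erase hx)
        have h1 := (hFA X hX).1.symm
        rw [← insert_erase haX, wSep_insert_bot hA1 (lt X hX)] at h1
        refine WSep.symm ?_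
        rw [← insert_erase haX, wSep_insert_bot hWa (lt X hX), card_insert_erase hb hnA]
        exact ⟨(hbG _ hXG).symm, exchange_lift hAn (hler X hX) hb h1.2 (hbG _ hXG)⟩
      · rw [erase_eq_of_notMem haX] at hXG
        exact hbG X hXG

theorem Surrounds.of_sdiff {I A B : Finset ℕ}
    (h : Surrounds (I \ A) (I \ B)) : Surrounds B A := by
  obtain ⟨x, y, z, hxy, hyz, ⟨h1, h2⟩, ⟨h3, h4⟩, h5, h6⟩ := h
  exact ⟨x, y, z, by grind⟩

theorem WSep.sdiff {I A B : Finset ℕ} (hA : A ⊆ I) (hB : B ⊆ I) (h : WSep A B) :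
    WSep (I \ A) (I \ B) := by
  have h1 := card_sdiff_add_card_eq_card hA
  have h2 := card_sdiff_add_card_eq_card hB
  refine ⟨fun h' => ?_, fun h' => ?_, fun h' => ?_⟩
  · have := h.2.1 (h'.of_sdiff)
    omega
  · have := h.1 (h'.of_sdiff)
    omega
  · exact h.2.2 ⟨h'.2.of_sdiff, h'.1.of_sdiff⟩

/-- The statement dual to `exists_exchange_wSep` under complementation. -/
theorem exists_insert_wSep {n a : ℕ} (han : a ≤ n) {F : Finset (Finset ℕ)}
    (hF : ∀ X ∈ F, X ⊆ Icc a n) (hFW : ∀ X ∈ F, ∀ Y ∈ F, WSep X Y) {A : Finset ℕ}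
    (hA : A ⊆ Ico a n) (hne : A ≠ Ico a n) (hFA : ∀ X ∈ F, WSep X A ∧ WSep X (insert n A)) :
    ∃ b ∈ Ico a n, b ∉ A ∧ ∀ X ∈ F, WSep X (insert b A) := by
  have hAn : n ∉ A := fun h => by simpa using hA h
  have hAI : A ⊆ Icc a n := hA.trans Ico_subset_Icc_self
  have hAI' : insert n A ⊆ Icc a n := insert_subset (by simp [han]) hAI
  have e1 : Icc a n \ insert n A = Ico a n \ A := by
    ext x; simp only [mem_sdiff, mem_Icc, mem_insert, mem_Ico]; grind
  have e2 : Icc a n \ A = insert n (Ico a n \ A) := by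
    ext x; simp only [mem_sdiff, mem_Icc, mem_insert, mem_Ico]; grind
  obtain ⟨b, hb, hbF⟩ := exists_exchange_wSep n (n - a) a (by omega)
    (F.image fun X => Icc a n \ X) (by simp) (by
      simp only [mem_image]
      rintro _ ⟨X, hX, rfl⟩ _ ⟨Y, hY, rfl⟩
      exact (hFW X hX Y hY).sdiff (hF X hX) (hF Y hY)) (Ico a n \ A) sdiff_subset
      (sdiff_nonempty.2 fun h => hne (hA.antisymm h)) (by
      simp only [mem_image]
      rintro _ ⟨X, hX, rfl⟩
      exact ⟨e1 ▸ (hFA X hX).2.sdiff (hF X hX) hAI', e2 ▸ (hFA X hX).1.sdiff (hF X hX) hAI⟩)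
  rw [mem_sdiff] at hb
  refine ⟨b, hb.1, hb.2, fun X hX => ?_⟩
  have h := (hbF _ (mem_image_of_mem _ hX)).sdiff sdiff_subset (by
    refine insert_subset (by simp [han]) ((erase_subset _ _).trans
      (sdiff_subset.trans Ico_subset_Icc_self)))
  rw [Finset.sdiff_sdiff_eq_self (hF X hX)] at h
  convert h using 1
  have := mem_Ico.1 hb.1
  ext x
  have := @hA x
  simp only [mem_sdiff, mem_Icc, mem_insert, mem_Ico, mem_erase] at *
  grind

theorem setLT_iff {A B : Finset ℕ} (hA : A.Nonempty) (hB : B.Nonempty) :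
    SetLT A B ↔ ∀ x ∈ A, ∀ y ∈ B, x < y := by
  simp only [SetLT, max0, min0, hA, hB, dif_pos, max'_lt_iff, lt_min'_iff]
  exact ⟨fun h x hx y hy => h y hy x hx, fun h y hy x hx => h x hx y hy⟩

theorem SetLT.lt {A B : Finset ℕ} (h : SetLT A B) : ∀ x ∈ A, ∀ y ∈ B, x < y :=
  fun x hx y hy => (setLT_iff ⟨x, hx⟩ ⟨y, hy⟩).1 h x hx y hy

theorem lessDot_of_precedes {A B : Finset ℕ} (hB : ∀ x ∈ B, 1 ≤ x) (hBA : ¬ B ⊆ A)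
    (h : Precedes A B) : LessDot A B := by
  have hne : (B \ A).Nonempty := sdiff_nonempty.2 hBA
  rcases (A \ B).eq_empty_or_nonempty with h0 | h0
  · rw [LessDot, SetLT, h0, min0, dif_pos hne]
    simp only [max0, Finset.not_nonempty_empty, dif_neg, not_false_eq_true, lt_min'_iff]
    exact fun y hy => hB y (mem_sdiff.1 hy).1
  · refine (setLT_iff h0 hne).2 fun x hx y hy => ?_
    rw [mem_sdiff] at hx hy
    exact h x hx.1 hx.2 y hy.1 hy.2

theorem LessDot.precedes {A B : Finset ℕ} (h : LessDot A B) : Precedes A B :=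
  fun x hx hx' y hy hy' => h.lt x (mem_sdiff.2 ⟨hx, hx'⟩) y (mem_sdiff.2 ⟨hy, hy'⟩)

theorem stronglySep_of_precedes {A B : Finset ℕ} (hA : ∀ x ∈ A, 1 ≤ x) (hB : ∀ x ∈ B, 1 ≤ x)
    (h : Precedes A B) : StronglySep A B := by
  by_cases h1 : B ⊆ A
  · by_cases h2 : A ⊆ B
    · exact Or.inr (Or.inr (h2.antisymm h1))
    · exact Or.inr (Or.inl (lessDot_of_precedes hA h2 fun x hx hx' => absurd (h1 hx) hx'))
  · exact Or.inl (lessDot_of_precedes hB h1 h)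

theorem StronglySep.wSep {A B : Finset ℕ} (h : StronglySep A B) : WSep A B := by
  rcases h with h | h | rfl
  · exact wSep_of_precedes h.precedes
  · exact (wSep_of_precedes h.precedes).symm
  · exact WSep.refl A

theorem Splits.not_surrounds {A B : Finset ℕ} (h : Splits A B) : ¬ Surrounds A B := by
  rintro ⟨x, y, z, hxy, hyz, hx, hy, hz⟩
  obtain ⟨_, B', B'', _, _, hB, h1, h2⟩ := h
  rw [← mem_sdiff] at hx hy hz
  rw [← hB, mem_union] at hy
  rcases hy with hy | hy
  · exact absurd (h1.lt y hy x hx) (by omega)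
  · exact absurd (h2.lt z hz y hy) (by omega)

theorem splits_of_surrounds {A B : Finset ℕ} (h : Surrounds B A) (h' : ¬ Surrounds A B) :
    Splits A B := by
  obtain ⟨x, y, z, hxy, hyz, hx, hy, hz⟩ := h
  have hx' := mem_sdiff.2 hx
  have hy' := mem_sdiff.2 hy
  have hz' := mem_sdiff.2 hz
  have hcmp : ∀ p ∈ B \ A, (∃ q ∈ A \ B, q < p) → ∀ q ∈ A \ B, q < p := by
    rintro p hp ⟨q, hq, hqp⟩ r hr
    rw [mem_sdiff] at hp hq hr
    by_contra! hpr
    have : p ≠ r := fun h => hp.2 (h ▸ hr.1)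
    exact h' ⟨q, p, r, hqp, by omega, hq, hp, hr⟩
  refine ⟨⟨y, hy'⟩, (B \ A).filter (· < y), (B \ A).filter (y < ·),
    ⟨x, mem_filter.2 ⟨hx', hxy⟩⟩, ⟨z, mem_filter.2 ⟨hz', hyz⟩⟩, ?_, ?_, ?_⟩
  · ext p
    simp only [mem_union, mem_filter]
    refine ⟨by tauto, fun hp => ?_⟩
    have : p ≠ y := fun h => hy.2 (h ▸ (mem_sdiff.1 hp).1)
    rcases lt_or_gt_of_ne this with h | h
    · exact Or.inl ⟨hp, h⟩
    · exact Or.inr ⟨hp, h⟩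
  · refine (setLT_iff ⟨x, mem_filter.2 ⟨hx', hxy⟩⟩ ⟨y, hy'⟩).2 fun p hp q hq => ?_
    rw [mem_filter] at hp
    by_contra! hqp
    have hne : q ≠ p := fun h => (mem_sdiff.1 hq).2 (h ▸ (mem_sdiff.1 hp.1).1)
    have := hcmp p hp.1 ⟨q, hq, by omega⟩ y hy'
    omega
  · refine (setLT_iff ⟨y, hy'⟩ ⟨z, mem_filter.2 ⟨hz', hyz⟩⟩).2 fun q hq p hp => ?_
    rw [mem_filter] at hp
    exact hcmp p hp.1 ⟨y, hy', hp.2⟩ q hq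

theorem weaklySep_iff_wSep {A B : Finset ℕ} (hA : ∀ x ∈ A, 1 ≤ x) (hB : ∀ x ∈ B, 1 ≤ x) :
    WeaklySep A B ↔ WSep A B := by
  constructor
  · rintro (h | ⟨h, hc⟩ | ⟨h, hc⟩)
    · exact h.wSep
    · exact ⟨fun h' => absurd h' h.not_surrounds, fun _ => hc, fun h' => h.not_surrounds h'.1⟩
    · exact ⟨fun _ => hc, fun h' => absurd h' h.not_surrounds, fun h' => h.not_surrounds h'.2⟩
  · intro h
    by_cases h1 : Surrounds A B
    · exact Or.inr (Or.inr ⟨splits_of_surrounds h1 fun h2 => h.2.2 ⟨h1, h2⟩, h.1 h1⟩)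
    · by_cases h2 : Surrounds B A
      · exact Or.inr (Or.inl ⟨splits_of_surrounds h2 h1, h.2.1 h2⟩)
      · refine Or.inl ?_
        rcases precedes_or h1 h2 with h | h
        · exact stronglySep_of_precedes hA hB h
        · rcases stronglySep_of_precedes hB hA h with h | h | h
          · exact Or.inr (Or.inl h)
          · exact Or.inl h
          · exact Or.inr (Or.inr h.symm)

theorem Surrounds.exists_middle_ne {A B : Finset ℕ} (h : Surrounds B A) (h' : ¬ Surrounds A B)
    (hc : A.card = B.card) (b : ℕ) :
    ∃ x y z, x < y ∧ y < z ∧ (x ∈ B ∧ x ∉ A) ∧ ((y ∈ A ∧ y ∉ B) ∧ y ≠ b) ∧ z ∈ B ∧ z ∉ A := by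
  obtain ⟨x, y, z, hxy, hyz, hx, hy, hz⟩ := h
  have h1 : 1 < (B \ A).card :=
    one_lt_card.2 ⟨x, mem_sdiff.2 hx, z, mem_sdiff.2 hz, by omega⟩
  rw [← card_sdiff_comm hc] at h1
  obtain ⟨w, hw, hwb⟩ := exists_mem_ne h1 b
  rw [mem_sdiff] at hw
  refine ⟨x, w, z, ?_, ?_, hx, ⟨hw, hwb⟩, hz⟩
  · by_contra! hle
    have : w ≠ x := fun e => hx.2 (e ▸ hw.1)
    exact h' ⟨w, x, y, by omega, hxy, hw, hx, hy⟩
  · by_contra! hle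
    have : w ≠ z := fun e => hz.2 (e ▸ hw.1)
    exact h' ⟨y, z, w, hyz, by omega, hy, hz, hw⟩

theorem not_surrounds_of_wSep_erase {A B : Finset ℕ} {b : ℕ} (hb : b ∈ A) (h : WSep A B)
    (hc : A.card = B.card) (hbB : WSep (A.erase b) B) : ¬ Surrounds B A := by
  intro hS
  obtain ⟨x, y, z, hxy, hyz, hx, hy, hz⟩ :=
    hS.exists_middle_ne (fun h' => h.2.2 ⟨h', hS⟩) hc b
  have := hbB.2.1 ⟨x, y, z, hxy, hyz, by grind⟩
  have := card_erase_lt_of_mem hb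
  omega

theorem not_surrounds_of_wSep_insert {A B : Finset ℕ} {b : ℕ} (hb : b ∉ A) (h : WSep A B)
    (hc : A.card = B.card) (hbB : WSep (insert b A) B) : ¬ Surrounds A B := by
  intro hS
  obtain ⟨x, y, z, hxy, hyz, hx, hy, hz⟩ :=
    hS.exists_middle_ne (fun h' => h.2.2 ⟨hS, h'⟩) hc.symm b
  have := hbB.1 ⟨x, y, z, hxy, hyz, by grind⟩
  rw [card_insert_of_notMem hb] at this
  omega

/-- `F` is a maximal pairwise weakly separated family of subsets of `I`. -/
structure IsMaxWSep (I : Finset ℕ) (F : Finset (Finset ℕ)) : Prop where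
  subset : ∀ X ∈ F, X ⊆ I
  wSep : ∀ X ∈ F, ∀ Y ∈ F, WSep X Y
  mem : ∀ Z ⊆ I, (∀ X ∈ F, WSep X Z) → Z ∈ F

section Slices

variable {N : ℕ} {F : Finset (Finset ℕ)}

/-- The members of `F` avoiding `N`. -/
def lowerSlice (N : ℕ) (F : Finset (Finset ℕ)) : Finset (Finset ℕ) := {X ∈ F | N ∉ X}

/-- The members of `F` containing `N`, with `N` removed. -/
def upperSlice (N : ℕ) (F : Finset (Finset ℕ)) : Finset (Finset ℕ) :=
  ({X ∈ F | N ∈ X}).image fun X => X.erase N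

theorem mem_lowerSlice {X : Finset ℕ} : X ∈ lowerSlice N F ↔ X ∈ F ∧ N ∉ X := mem_filter

theorem mem_upperSlice {X : Finset ℕ} : X ∈ upperSlice N F ↔ insert N X ∈ F ∧ N ∉ X := by
  simp only [upperSlice, mem_image, mem_filter]
  constructor
  · rintro ⟨Y, ⟨hY, hN⟩, rfl⟩
    exact ⟨by rwa [insert_erase hN], notMem_erase N Y⟩
  · rintro ⟨h, hN⟩
    exact ⟨insert N X, ⟨h, mem_insert_self N X⟩, erase_insert hN⟩

theorem card_lowerSlice_add_card_upperSlice :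
    (lowerSlice N F).card + (upperSlice N F).card = F.card := by
  rw [upperSlice, card_image_of_injOn, lowerSlice, add_comm]
  · exact card_filter_add_card_filter_not _
  · intro X hX Y hY h
    simp only [coe_filter, Set.mem_ofPred_eq] at hX hY
    rw [← insert_erase hX.2, ← insert_erase hY.2]
    exact congrArg (insert N) h

theorem forall_mem_of_slices {P : Finset ℕ → Prop} (hL : ∀ X ∈ lowerSlice N F, P X)
    (hR : ∀ X ∈ upperSlice N F, P (insert N X)) : ∀ X ∈ F, P X := by
  intro X hX
  by_cases hN : N ∈ X
  · rw [← insert_erase hN]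
    exact hR _ (mem_upperSlice.2 ⟨by rwa [insert_erase hN], notMem_erase N X⟩)
  · exact hL X (mem_lowerSlice.2 ⟨hX, hN⟩)

end Slices

namespace IsMaxWSep

variable {n : ℕ} {F : Finset (Finset ℕ)}

theorem slice_subset (hF : IsMaxWSep (Icc 1 (n + 1)) F) {X : Finset ℕ}
    (hX : X ∈ lowerSlice (n + 1) F ∪ upperSlice (n + 1) F) : X ⊆ Icc 1 n := by
  intro x hx
  rcases mem_union.1 hX with hX | hX
  · rw [mem_lowerSlice] at hX
    have := mem_Icc.1 (hF.subset X hX.1 hx)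
    have : x ≠ n + 1 := fun h => hX.2 (h ▸ hx)
    rw [mem_Icc]; omega
  · rw [mem_upperSlice] at hX
    have := mem_Icc.1 (hF.subset _ hX.1 (mem_insert_of_mem hx))
    have : x ≠ n + 1 := fun h => hX.2 (h ▸ hx)
    rw [mem_Icc]; omega

theorem lt_of_subset {X : Finset ℕ} (hX : X ⊆ Icc 1 n) : ∀ x ∈ X, x < n + 1 :=
  fun _ hx => Nat.lt_succ_of_le (mem_Icc.1 (hX hx)).2

theorem notMem_of_subset {X : Finset ℕ} (hX : X ⊆ Icc 1 n) : n + 1 ∉ X :=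
  fun h => lt_irrefl _ (lt_of_subset hX _ h)

theorem wSep_lower_upper (hF : IsMaxWSep (Icc 1 (n + 1)) F) {X Y : Finset ℕ}
    (hX : X ∈ lowerSlice (n + 1) F) (hY : Y ∈ upperSlice (n + 1) F) :
    WSep X Y ∧ (Precedes X Y ∨ Y.card < X.card) :=
  (wSep_insert_top (lt_of_subset (hF.slice_subset (mem_union_left _ hX)))
    (lt_of_subset (hF.slice_subset (mem_union_right _ hY)))).1
    (hF.wSep _ (mem_lowerSlice.1 hX).1 _ (mem_upperSlice.1 hY).1)

theorem wSep_slices (hF : IsMaxWSep (Icc 1 (n + 1)) F) :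
    ∀ X ∈ lowerSlice (n + 1) F ∪ upperSlice (n + 1) F,
    ∀ Y ∈ lowerSlice (n + 1) F ∪ upperSlice (n + 1) F, WSep X Y := by
  intro X hX Y hY
  rcases mem_union.1 hX with hX | hX <;> rcases mem_union.1 hY with hY | hY
  · exact hF.wSep _ (mem_lowerSlice.1 hX).1 _ (mem_lowerSlice.1 hY).1
  · exact (hF.wSep_lower_upper hX hY).1
  · exact (hF.wSep_lower_upper hY hX).1.symm
  · rw [mem_upperSlice] at hX hY
    exact (wSep_insert_insert hX.2 hY.2).1 (hF.wSep _ hX.1 _ hY.1)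

theorem exists_card_eq_mem_inter (hF : IsMaxWSep (Icc 1 (n + 1)) F) {k : ℕ} (hk : k ≤ n) :
    ∃ A ∈ lowerSlice (n + 1) F ∩ upperSlice (n + 1) F, A.card = k := by
  obtain ⟨A, hA, hAk, hAF⟩ :=
    exists_card_eq_wSep (n + 1) n 1 (by omega) F hF.subset hF.wSep k hk
  have hN : n + 1 ∉ A := fun h => by simpa using hA h
  have hAs := hA.trans Ico_subset_Icc_self
  refine ⟨A, mem_inter.2 ⟨mem_lowerSlice.2 ⟨hF.mem A hAs fun X hX => (hAF X hX).1, hN⟩,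
    mem_upperSlice.2 ⟨hF.mem _ ?_ fun X hX => (hAF X hX).2, hN⟩⟩, hAk⟩
  exact insert_subset (by simp) hAs

theorem card_inter_slices (hF : IsMaxWSep (Icc 1 (n + 1)) F) :
    (lowerSlice (n + 1) F ∩ upperSlice (n + 1) F).card = n + 1 := by
  refine (card_nbij (t := range (n + 1)) card (fun A hA => ?_) (fun A hA B hB h => ?_)
    (fun k hk => ?_)).trans (card_range _)
  · have hA := hF.slice_subset (mem_union_left _ (mem_inter.1 hA).1)
    have := card_le_card hA
    simp at this ⊢
    omega
  · rw [mem_coe, mem_inter] at hA hB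
    exact ((hF.wSep_lower_upper hA.1 hB.2).2.resolve_right h.le.not_gt).eq
      ((hF.wSep_lower_upper hB.1 hA.2).2.resolve_right h.ge.not_gt) h
  · obtain ⟨A, hA, hAk⟩ := hF.exists_card_eq_mem_inter (mem_range_succ_iff.1 hk)
    exact ⟨A, hA, hAk⟩

theorem mem_upperSlice_of_precedes (hF : IsMaxWSep (Icc 1 (n + 1)) F) {A Z : Finset ℕ}
    (hA : A ∈ upperSlice (n + 1) F) (hZ : Z ⊆ Icc 1 n)
    (hZF : ∀ X ∈ lowerSlice (n + 1) F ∪ upperSlice (n + 1) F, WSep X Z)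
    (hc : A.card = Z.card) (h : Precedes A Z) : Z ∈ upperSlice (n + 1) F := by
  have hN := notMem_of_subset hZ
  refine mem_upperSlice.2 ⟨hF.mem _ (insert_subset (by simp)
    (hZ.trans (Icc_subset_Icc_right n.le_succ))) (forall_mem_of_slices (N := n + 1) ?_ ?_), hN⟩
  · intro X hX
    have hXZ := hZF X (mem_union_left _ hX)
    rw [wSep_insert_top (lt_of_subset (hF.slice_subset (mem_union_left _ hX))) (lt_of_subset hZ)]
    refine ⟨hXZ, or_iff_not_imp_right.2 fun hlt => ?_⟩
    exact ((hF.wSep_lower_upper hX hA).2.resolve_right (by omega)).trans h (by omega) hc.le hXZ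
  · intro X hX
    rw [wSep_insert_insert (mem_upperSlice.1 hX).2 hN]
    exact hZF X (mem_union_right _ hX)

theorem mem_lowerSlice_of_precedes (hF : IsMaxWSep (Icc 1 (n + 1)) F) {A Z : Finset ℕ}
    (hA : A ∈ lowerSlice (n + 1) F) (hZ : Z ⊆ Icc 1 n)
    (hZF : ∀ X ∈ lowerSlice (n + 1) F ∪ upperSlice (n + 1) F, WSep X Z)
    (hc : A.card = Z.card) (h : Precedes Z A) : Z ∈ lowerSlice (n + 1) F := by
  refine mem_lowerSlice.2 ⟨hF.mem _ (hZ.trans (Icc_subset_Icc_right n.le_succ))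
    (forall_mem_of_slices (N := n + 1) ?_ ?_), notMem_of_subset hZ⟩
  · exact fun X hX => hZF X (mem_union_left _ hX)
  · intro X hX
    have hXZ := (hZF X (mem_union_right _ hX)).symm
    refine WSep.symm ?_
    rw [wSep_insert_top (lt_of_subset hZ) (lt_of_subset (hF.slice_subset (mem_union_right _ hX)))]
    refine ⟨hXZ, or_iff_not_imp_right.2 fun hlt => ?_⟩
    exact h.trans ((hF.wSep_lower_upper hA hX).2.resolve_right (by omega)) hc.ge (by omega) hXZ

theorem isMaxWSep_slices (hF : IsMaxWSep (Icc 1 (n + 1)) F) :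
    IsMaxWSep (Icc 1 n) (lowerSlice (n + 1) F ∪ upperSlice (n + 1) F) := by
  refine ⟨fun X hX => hF.slice_subset hX, hF.wSep_slices, fun Z hZ hZF => ?_⟩
  have hZc : Z.card ≤ n := by simpa using card_le_card hZ
  obtain ⟨A, hA, hc⟩ := hF.exists_card_eq_mem_inter hZc
  rw [mem_inter] at hA
  have hAL := mem_lowerSlice.1 hA.1
  have hAR := mem_upperSlice.1 hA.2
  have hAZ := hZF A (mem_union_left _ hA.1)
  have hIco : Icc 1 n = Ico 1 (n + 1) := rfl
  have hAs : A ⊆ Ico 1 (n + 1) := hF.slice_subset (mem_union_left _ hA.1)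
  have hAF : ∀ X ∈ F, WSep X A ∧ WSep X (insert (n + 1) A) := fun X hX =>
    ⟨hF.wSep X hX A hAL.1, hF.wSep X hX _ hAR.1⟩
  have h1 : ¬ Surrounds Z A := by
    intro hS
    have hne : A.Nonempty := by
      obtain ⟨_, y, _, _, _, _, hy, _⟩ := hS
      exact ⟨y, hy.1⟩
    obtain ⟨b, hb, hbF⟩ := exists_exchange_wSep (n + 1) n 1 (by omega) F hF.subset hF.wSep A
      hAs hne hAF
    refine not_surrounds_of_wSep_erase hb hAZ hc (hZF _ (mem_union_right _
      (mem_upperSlice.2 ⟨hF.mem _ ?_ hbF, fun h => hAR.2 (mem_of_mem_erase h)⟩))) hS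
    exact insert_subset (by simp) ((erase_subset b A).trans (hAs.trans Ico_subset_Icc_self))
  have h2 : ¬ Surrounds A Z := by
    intro hS
    have hne : A ≠ Ico 1 (n + 1) := by
      rintro rfl
      obtain ⟨_, y, _, _, _, _, hy, _⟩ := hS
      exact hy.2 (hZ hy.1)
    obtain ⟨b, hb, hbA, hbF⟩ := exists_insert_wSep (by omega) hF.subset hF.wSep hAs hne hAF
    have hbs : insert b A ⊆ Ico 1 (n + 1) := insert_subset hb hAs
    exact not_surrounds_of_wSep_insert hbA hAZ hc (hZF _ (mem_union_left _ (mem_lowerSlice.2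
      ⟨hF.mem _ (hbs.trans Ico_subset_Icc_self) hbF, notMem_of_subset hbs⟩))) hS
  rcases precedes_or h2 h1 with h | h
  · exact mem_union_right _ (hF.mem_upperSlice_of_precedes hA.2 hZ hZF hc h)
  · exact mem_union_left _ (hF.mem_lowerSlice_of_precedes hA.1 hZ hZF hc h)

theorem card_eq : ∀ {n : ℕ} {F : Finset (Finset ℕ)}, IsMaxWSep (Icc 1 n) F →
    F.card = n * (n + 1) / 2 + 1 := by
  intro n
  induction n with
  | zero =>
    intro F hF
    have hsub : ∀ X ∈ F, X = ∅ := fun X hX => subset_empty.1 (hF.subset X hX)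
    have : F = {∅} := by
      refine eq_singleton_iff_unique_mem.2 ⟨hF.mem _ (empty_subset _) fun X hX => ?_, hsub⟩
      rw [hsub X hX]
      exact WSep.refl ∅
    simp [this]
  | succ n ih =>
    intro F hF
    have h1 := ih hF.isMaxWSep_slices
    have h2 := hF.card_inter_slices
    have h3 := card_union_add_card_inter (lowerSlice (n + 1) F) (upperSlice (n + 1) F)
    have h4 := card_lowerSlice_add_card_upperSlice (N := n + 1) (F := F)
    have h5 : (n + 1) * (n + 1 + 1) = n * (n + 1) + (n + 1) * 2 := by ring
    rw [h5, Nat.add_mul_div_right _ _ two_pos]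
    omega

end IsMaxWSep

theorem IsMaxWColl.isMaxWSep {n : ℕ} {F : Finset (Finset ℕ)}
    (hF : IsMaxWColl {X : Finset ℕ | X ⊆ Icc 1 n} F) : IsMaxWSep (Icc 1 n) F := by
  obtain ⟨hs, hw, hm⟩ := hF
  have hpos : ∀ {X : Finset ℕ}, X ⊆ Icc 1 n → ∀ x ∈ X, 1 ≤ x := fun h x hx =>
    (mem_Icc.1 (h hx)).1
  have hs' : ∀ X ∈ F, X ⊆ Icc 1 n := fun X hX => hs hX
  refine ⟨hs', fun X hX Y hY => ?_, fun Z hZ hZF => ?_⟩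
  · exact (weaklySep_iff_wSep (hpos (hs' X hX)) (hpos (hs' Y hY))).1 (hw X hX Y hY)
  · rw [hm (insert Z F) ?_ ?_ (subset_insert Z F)]
    · exact mem_insert_self Z F
    · intro X hX
      rcases mem_insert.1 (mem_coe.1 hX) with rfl | hX
      · exact hZ
      · exact hs' X hX
    · intro X hXF Y hYF
      rcases mem_insert.1 hXF with rfl | hX <;> rcases mem_insert.1 hYF with rfl | hY
      · exact Or.inl (Or.inr (Or.inr rfl))
      · exact (weaklySep_iff_wSep (hpos hZ) (hpos (hs' Y hY))).2 (hZF Y hY).symm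
      · exact (weaklySep_iff_wSep (hpos (hs' X hX)) (hpos hZ)).2 (hZF X hX)
      · exact hw X hX Y hY

/-- the hyper-cube `2^[n]` is w-pure; moreover, every maximal
w-collection in `2^[n]` has cardinality `n(n+1)/2 + 1`. -/
theorem hypercube_w_pure (n : ℕ) (hn : 1 ≤ n) :
    WPure {X : Finset ℕ | X ⊆ Finset.Icc 1 n} ∧
    ∀ F : Finset (Finset ℕ), IsMaxWColl {X : Finset ℕ | X ⊆ Finset.Icc 1 n} F →
      F.card = n * (n + 1) / 2 + 1 :=
  ⟨fun _ _ hF hG => hF.isMaxWSep.card_eq.trans hG.isMaxWSep.card_eq.symm,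
    fun _ hF => hF.isMaxWSep.card_eq⟩
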